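/- Let σ = (S_1,…,S_s) ≤ π = (P_1,…,P_p) in OP_n. Then there exists a unique interval partition τ = (T_1,…,T_p) of [s], blocks listed in increasing order, such that π = (∪_{i∈T_1} S_i, ∪_{i∈T_2} S_i, …, ∪_{i∈T_p} S_i). Setting k_j = |T_j| (so k_j is the number of blocks of σ contained in P_j and k_1+⋯+k_p = s), the interval [σ,π] = {ρ ∈ OP_n : σ ≤ ρ ≤ π} with the order induced from OP_n is order-isomorphic to the product poset IP_{k_1} × IP_{k_2} × ⋯ × IP_{k_p}. -/

import Mathlib

open Finset

namespace OSPpaper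

/-- A *block* is a subset of `[n] = Fin n`. -/
abbrev Block (n : ℕ) := Finset (Fin n)

/-- `l` is an ordered set partition of the ground set `E ⊆ [n]`:
a finite sequence of pairwise disjoint nonempty subsets of `E` whose union is `E`. -/
def IsOSP {n : ℕ} (E : Finset (Fin n)) (l : List (Block n)) : Prop :=
  (∀ P ∈ l, P.Nonempty) ∧ l.Pairwise (fun P Q => Disjoint P Q) ∧
    (∀ P ∈ l, P ⊆ E) ∧ ∀ i ∈ E, ∃ P ∈ l, i ∈ P

/-- Union of a list of blocks. -/
def unionList {n : ℕ} (l : List (Block n)) : Block n := l.foldr (· ∪ ·) ∅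

/-- The order on ordered set partitions: `π ≤ σ` iff every block of `σ` is the union
of a contiguous run of blocks of `π` (runs taken in order). -/
def OSPle {n : ℕ} (π σ : List (Block n)) : Prop :=
  ∃ L : List (List (Block n)), L.flatten = π ∧ σ = L.map unionList

/-- The restriction `σ⌋_P`: intersect every block with `P` and delete the empty intersections. -/
def restrict {n : ℕ} (σ : List (Block n)) (P : Block n) : List (Block n) :=
  (σ.map (fun Q => Q ∩ P)).filter (fun Q => decide (Q ≠ ∅))

/-- The quasi-meet `π ⋏ σ`: the concatenation `σ⌋_{P₁} σ⌋_{P₂} ⋯ σ⌋_{P_p}`. -/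
def qmeet {n : ℕ} (π σ : List (Block n)) : List (Block n) :=
  (π.map (fun P => restrict σ P)).flatten

/-- Refinement: every block of `σ` is contained in some block of `τ`.
(As a relation on the underlying unordered partitions, this is the refinement order;
in particular `refines τ η` says `τ̄ ≤ η̄`.) -/
def refines {n : ℕ} (σ τ : List (Block n)) : Prop := ∀ P ∈ σ, ∃ Q ∈ τ, P ⊆ Q

/-- An interval partition of `[m]`, with its blocks listed in (the unique) increasing order:
an ordered set partition whose consecutive blocks are completely ordered. -/
def IsIP {m : ℕ} (l : List (Finset (Fin m))) : Prop :=
  IsOSP Finset.univ l ∧ l.Chain' (fun P Q => ∀ a ∈ P, ∀ b ∈ Q, a < b)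

/-- The (0-based) index `π(k)` of the block of `π` containing `k`. -/
def blockIdx {n : ℕ} (π : List (Block n)) (k : Fin n) : ℕ :=
  π.findIdx (fun P => decide (k ∈ P))

/-- The ordered kernel `κ(i₁,…,iₙ)` of a tuple: the nonempty level sets of the tuple,
listed in increasing order of the value. -/
def kernel {n : ℕ} (i : Fin n → ℕ) : List (Block n) :=
  ((Finset.image i Finset.univ).sort (· ≤ ·)).map
    (fun v => Finset.univ.filter (fun k => i k = v))

/-- `[σ:π] = ∏_{P ∈ π} #(σ⌋_P)`. -/
def colonNum {n : ℕ} (σ π : List (Block n)) : ℕ :=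
  (π.map (fun P => (restrict σ P).length)).prod

/-- `[σ:π]! = ∏_{P ∈ π} #(σ⌋_P)!`. -/
def colonFac {n : ℕ} (σ π : List (Block n)) : ℕ :=
  (π.map (fun P => Nat.factorial (restrict σ P).length)).prod

/-- For `τ̄ ≤ η̄` the sequence `(m_1,…,m_s)`: `m_i` is the (0-based) index of the block of `η`
containing the `i`-th block of `τ`. -/
def mseq {n : ℕ} (τ η : List (Block n)) : List ℕ :=
  τ.map (fun T => η.findIdx (fun E => decide (T ⊆ E)))

/-- number of ascents of a sequence -/
def ascL (l : List ℕ) : ℕ := ((l.zip l.tail).filter (fun p => decide (p.1 < p.2))).length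
/-- number of descents of a sequence -/
def desL (l : List ℕ) : ℕ := ((l.zip l.tail).filter (fun p => decide (p.2 < p.1))).length
/-- number of plateaux of a sequence -/
def platL (l : List ℕ) : ℕ := ((l.zip l.tail).filter (fun p => decide (p.1 = p.2))).length

/-- `asc_η(τ)` -/
def ascN {n : ℕ} (τ η : List (Block n)) : ℕ := ascL (mseq τ η)
/-- `des_η(τ)` -/
def desN {n : ℕ} (τ η : List (Block n)) : ℕ := desL (mseq τ η)
/-- `plat_η(τ)` -/
def platN {n : ℕ} (τ η : List (Block n)) : ℕ := platL (mseq τ η)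

/-- lengths of the maximal ascending runs of a sequence -/
def ascRunLengths (l : List ℕ) : List ℕ :=
  (l.splitBy (fun a b => decide (a < b))).map List.length
/-- lengths of the maximal level (constant) runs of a sequence -/
def levelRunLengths (l : List ℕ) : List ℕ :=
  (l.splitBy (fun a b => decide (a = b))).map List.length

/-- `μ̃(σ,π) = (−1)^{|σ|−|π|} / [σ:π]` (real-valued). -/
noncomputable def muR {n : ℕ} (σ π : List (Block n)) : ℝ :=
  (-1 : ℝ) ^ (σ.length - π.length) / (colonNum σ π : ℝ)

/-- `ζ̃(σ,π) = 1 / [σ:π]!` (real-valued). -/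
noncomputable def zetaR {n : ℕ} (σ π : List (Block n)) : ℝ :=
  1 / (colonFac σ π : ℝ)

/-- The Weisner coefficient `w(τ,η) = ∑_{σ ⋏ η = τ} μ̃(σ, 1̂ₙ)`. -/
noncomputable def wcoef {n : ℕ} (τ η : List (Block n)) : ℝ :=
  ∑ᶠ σ ∈ {σ : List (Block n) | IsOSP Finset.univ σ ∧ qmeet σ η = τ},
    muR σ [(Finset.univ : Block n)]

/-- The Goldberg coefficient `g(τ,η) = ∑_{σ ≥ τ} ζ̃(τ,σ) w(σ,η)`. -/
noncomputable def gcoef {n : ℕ} (τ η : List (Block n)) : ℝ :=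
  ∑ᶠ σ ∈ {σ : List (Block n) | IsOSP Finset.univ σ ∧ OSPle τ σ}, zetaR τ σ * wcoef σ η


section UnionList

variable {n : ℕ}

@[simp]
theorem mem_unionList {l : List (Block n)} {x : Fin n} :
    x ∈ unionList l ↔ ∃ P ∈ l, x ∈ P := by
  induction l with
  | nil => simp [unionList]
  | cons P l ih =>
    have h : unionList (P :: l) = P ∪ unionList l := rfl
    simp [h, ih]

theorem unionList_flatten (L : List (List (Block n))) :
    unionList L.flatten = unionList (L.map unionList) := by
  ext x
  simp only [mem_unionList, List.mem_flatten, List.mem_map]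
  constructor
  · rintro ⟨P, ⟨l, hl, hP⟩, hx⟩
    exact ⟨_, ⟨l, hl, rfl⟩, mem_unionList.2 ⟨P, hP, hx⟩⟩
  · rintro ⟨_, ⟨l, hl, rfl⟩, hx⟩
    obtain ⟨P, hP, hx⟩ := mem_unionList.1 hx
    exact ⟨P, ⟨l, hl, hP⟩, hx⟩

theorem unionList_map_sup {m : ℕ} (g : Fin m → Block n) (l : List (Finset (Fin m))) :
    unionList (l.map fun T => T.sup g) = (unionList l).sup g := by
  ext x
  simp only [mem_unionList, List.mem_map, Finset.mem_sup]
  constructor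
  · rintro ⟨_, ⟨T, hT, rfl⟩, hx⟩
    obtain ⟨i, hi, hx⟩ := Finset.mem_sup.1 hx
    exact ⟨i, ⟨T, hT, hi⟩, hx⟩
  · rintro ⟨i, ⟨T, hT, hi⟩, hx⟩
    exact ⟨_, ⟨T, hT, rfl⟩, Finset.mem_sup.2 ⟨i, hi, hx⟩⟩

theorem unionList_map_sort {m : ℕ} (g : Fin m → Block n) (T : Finset (Fin m)) :
    unionList (T.sort.map g) = T.sup g := by
  ext x
  simp [Finset.mem_sup]

theorem unionList_map_toFinset {m : ℕ} (g : Fin m → Block n) (l : List (Fin m)) :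
    unionList (l.map g) = l.toFinset.sup g := by
  ext x
  simp [Finset.mem_sup]

end UnionList

section Coarsening

variable {n : ℕ}

theorem exists_flatten_eq_of_map_eq_flatten {α β : Type*} (f : α → β) {x : List α}
    {L : List (List β)} (h : x.map f = L.flatten) :
    ∃ N : List (List α), N.flatten = x ∧ N.map (List.map f) = L := by
  induction L generalizing x with
  | nil => exact ⟨[], by simpa using h⟩
  | cons l L ih =>
    obtain ⟨a, b, rfl, rfl, hb⟩ := List.map_eq_append_iff.1 h
    obtain ⟨N, rfl, rfl⟩ := ih hb
    exact ⟨a :: N, rfl, rfl⟩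

theorem OSPle.unionList_eq {π σ : List (Block n)} (h : OSPle π σ) :
    unionList σ = unionList π := by
  obtain ⟨L, rfl, rfl⟩ := h
  exact (unionList_flatten L).symm

theorem OSPle.refines {π σ : List (Block n)} (h : OSPle π σ) : refines π σ := by
  obtain ⟨L, rfl, rfl⟩ := h
  intro P hP
  obtain ⟨l, hl, hP⟩ := List.mem_flatten.1 hP
  exact ⟨_, List.mem_map_of_mem hl, fun x hx => mem_unionList.2 ⟨P, hP, hx⟩⟩

theorem OSPle.map_sup {m : ℕ} (g : Fin m → Block n) {l l' : List (Finset (Fin m))}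
    (h : OSPle l l') : OSPle (l.map fun T => T.sup g) (l'.map fun T => T.sup g) := by
  obtain ⟨L, rfl, rfl⟩ := h
  refine ⟨L.map (List.map fun T => T.sup g), by simp, ?_⟩
  simp [unionList_map_sup]

theorem OSPle.flatten_ofFn {p : ℕ} {a b : Fin p → List (Block n)}
    (h : ∀ j, OSPle (a j) (b j)) : OSPle (List.ofFn a).flatten (List.ofFn b).flatten := by
  choose L hL hL' using h
  refine ⟨(List.ofFn L).flatten, ?_, ?_⟩
  · rw [List.flatten_flatten, List.map_ofFn]
    exact congrArg (fun f => (List.ofFn f).flatten) (funext hL)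
  · rw [List.map_flatten, List.map_ofFn]
    exact congrArg (fun f => (List.ofFn f).flatten) (funext hL')

theorem OSPle.pairwise_disjoint {π σ : List (Block n)} (h : OSPle π σ)
    (hπ : π.Pairwise fun P Q => Disjoint P Q) : σ.Pairwise fun P Q => Disjoint P Q := by
  obtain ⟨L, rfl, rfl⟩ := h
  rw [List.pairwise_map]
  refine (List.pairwise_flatten.1 hπ).2.imp fun {l l'} h => ?_
  simp only [Finset.disjoint_left, mem_unionList] at h ⊢
  rintro x ⟨P, hP, hx⟩ ⟨Q, hQ, hx'⟩
  exact h P hP Q hQ hx hx'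

/-- An ordered set partition determines the runs of blocks that are merged in a coarsening. -/
theorem eq_map_filter_of_flatten {L : List (List (Block n))}
    (hne : ∀ P ∈ L.flatten, P.Nonempty)
    (hdisj : (L.map unionList).Pairwise fun P Q => Disjoint P Q) :
    L = (L.map unionList).map fun P => L.flatten.filter fun Q => decide (Q ⊆ P) := by
  have key : ∀ X ∈ L, ∀ l ∈ L, Disjoint (unionList l) (unionList X) →
      l.filter (fun Q => decide (Q ⊆ unionList X)) = [] := by
    intro X _ l hl hd
    refine List.filter_eq_nil_iff.2 fun Q hQ hQX => ?_
    obtain ⟨x, hx⟩ := hne Q (List.mem_flatten.2 ⟨l, hl, hQ⟩)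
    exact Finset.disjoint_left.1 hd (mem_unionList.2 ⟨Q, hQ, hx⟩) (of_decide_eq_true hQX hx)
  conv_lhs => rw [← List.map_id L]
  rw [List.map_map]
  refine List.map_congr_left fun X hX => ?_
  obtain ⟨A, B, rfl⟩ := List.append_of_mem hX
  simp only [List.map_append, List.map_cons, List.pairwise_append, List.pairwise_cons,
    List.mem_map, List.mem_cons] at hdisj
  have hA : A.flatten.filter (fun Q => decide (Q ⊆ unionList X)) = [] := by
    rw [List.filter_flatten, List.flatten_eq_nil_iff]
    simp only [List.mem_map]
    rintro _ ⟨l, hl, rfl⟩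
    exact key X hX l (by simp [hl]) (hdisj.2.2 _ ⟨l, hl, rfl⟩ _ (Or.inl rfl))
  have hB : B.flatten.filter (fun Q => decide (Q ⊆ unionList X)) = [] := by
    rw [List.filter_flatten, List.flatten_eq_nil_iff]
    simp only [List.mem_map]
    rintro _ ⟨l, hl, rfl⟩
    exact key X hX l (by simp [hl]) (hdisj.2.1.1 _ ⟨l, hl, rfl⟩).symm
  have hX' : X.filter (fun Q => decide (Q ⊆ unionList X)) = X :=
    List.filter_eq_self.2 fun Q hQ =>
      decide_eq_true fun x hx => mem_unionList.2 ⟨Q, hQ, hx⟩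
  rw [Function.comp_apply, List.flatten_append, List.flatten_cons, List.filter_append,
    List.filter_append, hA, hB, hX', List.nil_append, List.append_nil]
  rfl

end Coarsening

section IntervalPartition

variable {m : ℕ}

theorem IsIP.pairwise_lt {l : List (Finset (Fin m))} (h : IsIP l) :
    l.Pairwise fun P Q => ∀ a ∈ P, ∀ b ∈ Q, a < b := by
  obtain ⟨⟨hne, -, -, -⟩, hc⟩ := h
  induction l with
  | nil => exact List.Pairwise.nil
  | cons P l ih =>
    have hl := ih hc.tail fun Q hQ => hne Q (List.mem_cons_of_mem _ hQ)
    refine List.pairwise_cons.2 ⟨fun Q hQ a ha b hb => ?_, hl⟩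
    cases l with
    | nil => simp at hQ
    | cons R l =>
      have hPR := (List.isChain_cons_cons.1 hc).1
      rcases List.mem_cons.1 hQ with rfl | hQ
      · exact hPR a ha b hb
      · obtain ⟨c, hcR⟩ := hne R (by simp)
        exact (hPR a ha c hcR).trans ((List.pairwise_cons.1 hl).1 Q hQ c hcR b hb)

theorem IsIP.flatten_map_sort {l : List (Finset (Fin m))} (h : IsIP l) :
    (l.map fun T => T.sort).flatten = List.finRange m := by
  have hlt : (l.map fun T => T.sort).flatten.Pairwise (· < ·) := by
    rw [List.pairwise_flatten]
    constructor
    · simp only [List.mem_map]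
      rintro _ ⟨T, -, rfl⟩
      exact T.sortedLT_sort.pairwise
    · rw [List.pairwise_map]
      exact h.pairwise_lt.imp fun {P Q} hPQ a ha b hb =>
        hPQ a (by simpa using ha) b (by simpa using hb)
  refine List.Perm.eq_of_pairwise (le := (· < ·)) (fun a b _ _ hab hba => (lt_asymm hab hba).elim)
    hlt (List.pairwise_lt_finRange m) ?_
  refine (List.perm_ext_iff_of_nodup (hlt.imp fun h => ne_of_lt h) (List.nodup_finRange m)).2
    fun i => ?_
  obtain ⟨P, hP, hi⟩ := h.1.2.2.2 i (Finset.mem_univ i)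
  simpa using ⟨P, hP, hi⟩

theorem isIP_map_toFinset {N : List (List (Fin m))} (hne : ∀ l ∈ N, l ≠ [])
    (hN : N.flatten = List.finRange m) : IsIP (N.map List.toFinset) := by
  have hp := List.pairwise_lt_finRange m
  rw [← hN, List.pairwise_flatten] at hp
  have hlt : (N.map List.toFinset).Pairwise fun P Q => ∀ a ∈ P, ∀ b ∈ Q, a < b := by
    rw [List.pairwise_map]
    exact hp.2.imp fun h a ha b hb => h a (by simpa using ha) b (by simpa using hb)
  refine ⟨⟨?_, hlt.imp fun h => Finset.disjoint_left.2 fun a ha hb => lt_irrefl a (h a ha a hb),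
    fun _ _ => Finset.subset_univ _, fun i _ => ?_⟩, hlt.isChain⟩
  · simp only [List.mem_map]
    rintro _ ⟨l, hl, rfl⟩
    simpa using hne l hl
  · have hi : i ∈ N.flatten := hN ▸ List.mem_finRange i
    obtain ⟨l, hl, hi⟩ := List.mem_flatten.1 hi
    exact ⟨_, List.mem_map_of_mem hl, by simpa using hi⟩

theorem eq_of_pairwise_lt_of_mem_iff {l l' : List (Finset (Fin m))}
    (hne : ∀ P ∈ l, P.Nonempty)
    (hl : l.Pairwise fun P Q => ∀ a ∈ P, ∀ b ∈ Q, a < b)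
    (hl' : l'.Pairwise fun P Q => ∀ a ∈ P, ∀ b ∈ Q, a < b)
    (h : ∀ P, P ∈ l ↔ P ∈ l') : l = l' := by
  have hnd : ∀ {k : List (Finset (Fin m))}, (∀ P ∈ k, P.Nonempty) →
      k.Pairwise (fun P Q => ∀ a ∈ P, ∀ b ∈ Q, a < b) → k.Nodup := by
    intro k hk hp
    refine hp.imp_of_mem fun {P Q} hP _ hPQ hEq => ?_
    obtain ⟨a, ha⟩ := hk P hP
    exact lt_irrefl a (hPQ a ha a (hEq ▸ ha))
  refine List.Perm.eq_of_pairwise (fun P Q hP hQ hPQ hQP => ?_) hl hl'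
    ((List.perm_ext_iff_of_nodup (hnd hne hl)
      (hnd (fun P hP => hne P ((h P).2 hP)) hl')).2 h)
  obtain ⟨a, ha⟩ := hne P hP
  obtain ⟨b, hb⟩ := hne Q ((h Q).2 hQ)
  exact (lt_asymm (hPQ a ha b hb) (hQP b hb a ha)).elim

theorem IsIP.eq_of_mem {l : List (Finset (Fin m))} (h : IsIP l) {P Q : Finset (Fin m)}
    (hP : P ∈ l) (hQ : Q ∈ l) {a : Fin m} (haP : a ∈ P) (haQ : a ∈ Q) : P = Q := by
  by_contra hne
  exact Finset.disjoint_left.1 (h.1.2.1.forall hP hQ hne) haP haQ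

theorem IsIP.ospLE_of_refines {l l' : List (Finset (Fin m))} (h : IsIP l) (h' : IsIP l')
    (hr : refines l l') : OSPle l l' := by
  refine ⟨l'.map fun T => l.filter fun P => decide (P ⊆ T), ?_, ?_⟩
  · refine (eq_of_pairwise_lt_of_mem_iff h.1.1 h.pairwise_lt ?_ fun P => ?_).symm
    · rw [List.pairwise_flatten]
      constructor
      · simp only [List.mem_map]
        rintro _ ⟨T, -, rfl⟩
        exact h.pairwise_lt.filter _
      · rw [List.pairwise_map]
        refine h'.pairwise_lt.imp fun {T T'} hT P hP Q hQ a ha b hb => ?_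
        simp only [List.mem_filter, decide_eq_true_eq] at hP hQ
        exact hT a (hP.2 ha) b (hQ.2 hb)
    · simp only [List.mem_flatten, List.mem_map]
      constructor
      · intro hP
        obtain ⟨T, hT, hPT⟩ := hr P hP
        exact ⟨_, ⟨T, hT, rfl⟩, by simp [hP, hPT]⟩
      · rintro ⟨_, ⟨T, -, rfl⟩, hP⟩
        exact (List.mem_filter.1 hP).1
  · rw [List.map_map]
    conv_lhs => rw [← List.map_id l']
    refine List.map_congr_left fun T hT => ?_
    ext x
    simp only [id, Function.comp_apply, mem_unionList, List.mem_filter, decide_eq_true_eq]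
    constructor
    · intro hx
      obtain ⟨P, hP, hxP⟩ := h.1.2.2.2 x (Finset.mem_univ x)
      obtain ⟨T', hT', hPT'⟩ := hr P hP
      exact ⟨P, ⟨hP, h'.eq_of_mem hT' hT (hPT' hxP) hx ▸ hPT'⟩, hxP⟩
    · rintro ⟨P, ⟨-, hPT⟩, hx⟩
      exact hPT hx

theorem IsIP.eq_of_refines {l l' : List (Finset (Fin m))} (h : IsIP l) (h' : IsIP l')
    (hr : refines l l') (hr' : refines l' l) : l = l' := by
  have aux : ∀ {k k' : List (Finset (Fin m))}, IsIP k → refines k k' → refines k' k →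
      ∀ P ∈ k, P ∈ k' := by
    intro k k' hk h₁ h₂ P hP
    obtain ⟨Q, hQ, hPQ⟩ := h₁ P hP
    obtain ⟨R, hR, hQR⟩ := h₂ Q hQ
    obtain ⟨a, ha⟩ := hk.1.1 P hP
    obtain rfl := hk.eq_of_mem hP hR ha (hQR (hPQ ha))
    exact hPQ.antisymm hQR ▸ hQ
  exact eq_of_pairwise_lt_of_mem_iff h.1.1 h.pairwise_lt h'.pairwise_lt
    fun P => ⟨aux h hr hr' P, aux h' hr' hr P⟩

end IntervalPartition

section Merge

variable {n m : ℕ} {g : Fin m → Block n}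

theorem subset_of_sup_subset_sup (hne : ∀ i, (g i).Nonempty)
    (hdisj : ∀ i j, i ≠ j → Disjoint (g i) (g j)) {T T' : Finset (Fin m)}
    (h : T.sup g ⊆ T'.sup g) : T ⊆ T' := by
  intro i hi
  obtain ⟨x, hx⟩ := hne i
  obtain ⟨j, hj, hxj⟩ := Finset.mem_sup.1 (h (Finset.mem_sup.2 ⟨i, hi, hx⟩))
  by_contra hiT'
  exact Finset.disjoint_left.1 (hdisj i j fun hij => hiT' (hij ▸ hj)) hx hxj

theorem sup_injective (hne : ∀ i, (g i).Nonempty)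
    (hdisj : ∀ i j, i ≠ j → Disjoint (g i) (g j)) :
    Function.Injective fun T : Finset (Fin m) => T.sup g := fun _ _ h =>
  (subset_of_sup_subset_sup hne hdisj (subset_of_eq h)).antisymm
    (subset_of_sup_subset_sup hne hdisj (subset_of_eq h.symm))

theorem sup_nonempty (hne : ∀ i, (g i).Nonempty) {T : Finset (Fin m)} (hT : T.Nonempty) :
    (T.sup g).Nonempty := by
  obtain ⟨i, hi⟩ := hT
  obtain ⟨x, hx⟩ := hne i
  exact ⟨x, Finset.mem_sup.2 ⟨i, hi, hx⟩⟩

theorem IsIP.flatten_map_sort_map {l : List (Finset (Fin m))} (h : IsIP l)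
    (g : Fin m → Block n) : (l.map fun T => T.sort.map g).flatten = List.ofFn g := by
  rw [List.ofFn_eq_map, ← h.flatten_map_sort, List.map_flatten, List.map_map]
  rfl

theorem IsIP.ospLE_ofFn {l : List (Finset (Fin m))} (h : IsIP l) (g : Fin m → Block n) :
    OSPle (List.ofFn g) (l.map fun T => T.sup g) :=
  ⟨_, h.flatten_map_sort_map g, by simp [Function.comp_def, unionList_map_sort]⟩

theorem OSPle.exists_isIP {ρ : List (Block n)} (h : OSPle (List.ofFn g) ρ)
    (hne : ∀ P ∈ ρ, P.Nonempty) :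
    ∃ l : List (Finset (Fin m)), IsIP l ∧ ρ = l.map fun T => T.sup g := by
  obtain ⟨L, hL, rfl⟩ := h
  rw [List.ofFn_eq_map] at hL
  obtain ⟨N, hN, rfl⟩ := exists_flatten_eq_of_map_eq_flatten g hL.symm
  refine ⟨_, isIP_map_toFinset (fun l hl h_nil => ?_) hN, ?_⟩
  · subst h_nil
    obtain ⟨x, hx⟩ := hne _ (List.mem_map_of_mem (List.mem_map_of_mem hl))
    simp at hx
  · simp [Function.comp_def, unionList_map_toFinset]

theorem length_restrict_ofFn (hne : ∀ i, (g i).Nonempty)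
    (hdisj : ∀ i j, i ≠ j → Disjoint (g i) (g j)) (T : Finset (Fin m)) :
    (restrict (List.ofFn g) (T.sup g)).length = T.card := by
  have hiff : ∀ i, g i ∩ T.sup g ≠ ∅ ↔ i ∈ T := by
    intro i
    rw [← Finset.nonempty_iff_ne_empty]
    constructor
    · rintro ⟨x, hx⟩
      obtain ⟨hxi, hx⟩ := Finset.mem_inter.1 hx
      obtain ⟨j, hj, hxj⟩ := Finset.mem_sup.1 hx
      by_contra hi
      exact Finset.disjoint_left.1 (hdisj i j fun hij => hi (hij ▸ hj)) hxi hxj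
    · intro hi
      obtain ⟨x, hx⟩ := hne i
      exact ⟨x, Finset.mem_inter.2 ⟨hx, Finset.mem_sup.2 ⟨i, hi, hx⟩⟩⟩
  rw [restrict, List.ofFn_eq_map, List.map_map, List.filter_map, List.length_map]
  have hfun : ((fun Q : Block n => decide (Q ≠ ∅)) ∘ (fun Q => Q ∩ T.sup g) ∘ g) =
      fun i => decide (i ∈ T) := by
    funext i
    simp only [Function.comp_apply, hiff]
  have hT : ((List.finRange m).filter fun i => decide (i ∈ T)).toFinset = T := by
    ext i
    simp
  rw [hfun, ← List.toFinset_card_of_nodup ((List.nodup_finRange m).filter _), hT]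

theorem refines_map_sup_iff (hne : ∀ i, (g i).Nonempty)
    (hdisj : ∀ i j, i ≠ j → Disjoint (g i) (g j)) {l l' : List (Finset (Fin m))} :
    refines (l.map fun T => T.sup g) (l'.map fun T => T.sup g) ↔ refines l l' := by
  simp only [refines, List.mem_map, forall_exists_index, and_imp, forall_apply_eq_imp_iff₂,
    exists_exists_and_eq_and]
  exact forall₂_congr fun T _ => exists_congr fun T' => and_congr_right fun _ =>
    ⟨subset_of_sup_subset_sup hne hdisj, Finset.sup_mono⟩

end Merge

section Splitting

variable {n p : ℕ}

theorem mem_flatten_ofFn {α : Type*} {M : Fin p → List α} {a : α} :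
    a ∈ (List.ofFn M).flatten ↔ ∃ j, a ∈ M j := by
  simp [List.mem_flatten, List.mem_ofFn]

theorem exists_ofFn_eq {α : Type*} {l : List α} (h : l.length = p) :
    ∃ f : Fin p → α, List.ofFn f = l := by
  subst h
  exact ⟨l.get, List.ofFn_get l⟩

theorem OSPle.exists_split {σ ρ : List (Block n)} {L : Fin p → List (Block n)}
    (hne : ∀ P ∈ σ, P.Nonempty) (hL : (List.ofFn L).flatten = σ)
    (hdisj : (List.ofFn fun j => unionList (L j)).Pairwise fun P Q => Disjoint P Q)
    (hσρ : OSPle σ ρ) (hρ : OSPle ρ (List.ofFn fun j => unionList (L j))) :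
    ∃ M : Fin p → List (Block n),
      (List.ofFn M).flatten = ρ ∧ ∀ j, OSPle (L j) (M j) := by
  obtain ⟨N, rfl, rfl⟩ := hσρ
  obtain ⟨M, hM, hMπ⟩ := hρ
  obtain ⟨K, rfl, rfl⟩ := exists_flatten_eq_of_map_eq_flatten unionList hM.symm
  obtain ⟨K, rfl⟩ := exists_ofFn_eq (p := p) (l := K)
    (by simpa using (congrArg List.length hMπ).symm)
  have hK : List.ofFn L = List.ofFn fun j => (K j).flatten := by
    have hflat : (List.ofFn fun j => (K j).flatten).flatten = (List.ofFn L).flatten := by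
      rw [hL, List.flatten_flatten, List.map_ofFn]
      rfl
    have hmap : (List.ofFn fun j => (K j).flatten).map unionList =
        (List.ofFn L).map unionList := by
      simp only [List.map_ofFn] at hMπ ⊢
      rw [show List.ofFn (unionList ∘ L) = List.ofFn fun j => unionList (L j) from rfl, hMπ]
      exact congrArg List.ofFn (funext fun j => unionList_flatten (K j))
    have hdisj' : ((List.ofFn L).map unionList).Pairwise fun P Q => Disjoint P Q := by
      rw [List.map_ofFn]
      exact hdisj
    rw [eq_map_filter_of_flatten (L := List.ofFn L) (by rwa [hL]) hdisj',
      eq_map_filter_of_flatten (L := List.ofFn fun j => (K j).flatten)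
        (by rwa [hflat, hL]) (by rwa [hmap]), hflat, hmap]
  refine ⟨fun j => (K j).map unionList, ?_, fun j => ⟨K j, ?_, rfl⟩⟩
  · rw [List.map_flatten, List.map_ofFn]
    rfl
  · exact (congrFun (List.ofFn_injective hK) j).symm

theorem refines_of_refines_flatten_ofFn {P : Fin p → Block n}
    (hP : ∀ i j, i ≠ j → Disjoint (P i) (P j)) {M M' : Fin p → List (Block n)}
    (hne : ∀ j, ∀ A ∈ M j, A.Nonempty) (hM : ∀ j, unionList (M j) = P j)
    (hM' : ∀ j, unionList (M' j) = P j)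
    (h : refines (List.ofFn M).flatten (List.ofFn M').flatten) (j : Fin p) :
    refines (M j) (M' j) := by
  intro A hA
  obtain ⟨B, hB, hAB⟩ := h A (mem_flatten_ofFn.2 ⟨j, hA⟩)
  obtain ⟨j', hB⟩ := mem_flatten_ofFn.1 hB
  obtain ⟨x, hx⟩ := hne j A hA
  have hj : j = j' := by
    by_contra hjj'
    refine Finset.disjoint_left.1 (hP j j' hjj') (?_ : x ∈ P j) ?_
    · rw [← hM j]
      exact mem_unionList.2 ⟨A, hA, hx⟩
    · rw [← hM' j']
      exact mem_unionList.2 ⟨B, hB, hAB hx⟩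
  subst hj
  exact ⟨B, hB, hAB⟩

end Splitting

section Interval

variable {n : ℕ}

theorem IsOSP.disjoint_get {E : Finset (Fin n)} {σ : List (Block n)} (h : IsOSP E σ)
    (i j : Fin σ.length) (hij : i ≠ j) : Disjoint (σ.get i) (σ.get j) := by
  have hp := List.pairwise_iff_get.1 h.2.1
  rcases lt_or_gt_of_ne hij with hlt | hlt
  · exact hp i j hlt
  · exact (hp j i hlt).symm

theorem IsOSP.of_ospLE {σ ρ : List (Block n)} (h : IsOSP Finset.univ σ) (hσρ : OSPle σ ρ)
    (hne : ∀ P ∈ ρ, P.Nonempty) : IsOSP Finset.univ ρ := by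
  refine ⟨hne, hσρ.pairwise_disjoint h.2.1, fun _ _ => Finset.subset_univ _, fun i hi => ?_⟩
  rw [← mem_unionList, hσρ.unionList_eq]
  exact mem_unionList.2 (h.2.2.2 i hi)

/-- The interval above `σ` and below the merging of `σ` along an interval partition `τ`
is a product of lattices of interval partitions. -/
theorem exists_interval_equiv {σ : List (Block n)} (hσ : IsOSP Finset.univ σ)
    {τ : List (Finset (Fin σ.length))} (hτ : IsIP τ)
    (hπ : IsOSP Finset.univ (τ.map fun T => T.sup fun i => σ.get i)) :
    ∃ Φ : {ρ : List (Block n) // IsOSP Finset.univ ρ ∧ OSPle σ ρ ∧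
            OSPle ρ (τ.map fun T => T.sup fun i => σ.get i)} →
          ((j : Fin τ.length) → {l : List (Finset (Fin (τ.get j).card)) // IsIP l}),
        Function.Bijective Φ ∧
        ∀ ρ ρ', OSPle ρ.val ρ'.val ↔ ∀ j, refines ((Φ ρ) j).val ((Φ ρ') j).val := by
  have hσne : ∀ i, (σ.get i).Nonempty := fun i => hσ.1 _ (List.get_mem σ i)
  let P : Fin τ.length → Block n := fun j => (τ.get j).sup fun i => σ.get i
  have hP : (τ.map fun T => T.sup fun i => σ.get i) = List.ofFn P := by
    conv_lhs => rw [← List.ofFn_get τ, List.map_ofFn]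
    rfl
  rw [hP] at hπ ⊢
  have hPdisj : ∀ i j, i ≠ j → Disjoint (P i) (P j) := by
    intro i j hij
    have hp := List.pairwise_ofFn.1 hπ.2.1
    rcases lt_or_gt_of_ne hij with hlt | hlt
    · exact hp hlt
    · exact (hp hlt).symm
  let g : (j : Fin τ.length) → Fin (τ.get j).card → Block n :=
    fun j i => σ.get ((τ.get j).orderEmbOfFin rfl i)
  have hgne : ∀ j i, (g j i).Nonempty := fun j i => hσne _
  have hgdisj : ∀ j i i', i ≠ i' → Disjoint (g j i) (g j i') := fun j i i' hii' =>
    hσ.disjoint_get _ _ fun h => hii' (((τ.get j).orderEmbOfFin rfl).injective h)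
  have hg : ∀ j, List.ofFn (g j) = (τ.get j).sort.map fun i => σ.get i := by
    intro j
    rw [← (τ.get j).listMap_orderEmbOfFin_finRange rfl, List.map_map, List.ofFn_eq_map]
    rfl
  have hgP : ∀ j, unionList (List.ofFn (g j)) = P j := fun j => by
    rw [hg, unionList_map_sort]
  have hgσ : (List.ofFn fun j => List.ofFn (g j)).flatten = σ := by
    have h := hτ.flatten_map_sort_map fun i => σ.get i
    rw [← List.ofFn_get τ, List.map_ofFn] at h
    simp only [hg]
    exact h.trans (List.ofFn_get σ)
  let M : ((j : Fin τ.length) → {l : List (Finset (Fin (τ.get j).card)) // IsIP l}) →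
      Fin τ.length → List (Block n) := fun f j => (f j).val.map fun T => T.sup (g j)
  have hgM : ∀ f j, OSPle (List.ofFn (g j)) (M f j) := fun f j => (f j).2.ospLE_ofFn (g j)
  have hMP : ∀ f j, unionList (M f j) = P j := fun f j => (hgM f j).unionList_eq.trans (hgP j)
  have hMne : ∀ f j, ∀ A ∈ M f j, A.Nonempty := by
    intro f j A hA
    obtain ⟨T, hT, rfl⟩ := List.mem_map.1 hA
    exact sup_nonempty (hgne j) ((f j).2.1.1 T hT)
  have hσM : ∀ f, OSPle σ (List.ofFn (M f)).flatten := fun f => by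
    conv_lhs => rw [← hgσ]
    exact OSPle.flatten_ofFn (hgM f)
  let Ψ : ((j : Fin τ.length) → {l : List (Finset (Fin (τ.get j).card)) // IsIP l}) →
      {ρ : List (Block n) // IsOSP Finset.univ ρ ∧ OSPle σ ρ ∧ OSPle ρ (List.ofFn P)} :=
    fun f => ⟨(List.ofFn (M f)).flatten,
      hσ.of_ospLE (hσM f) fun A hA => by
        obtain ⟨j, hA⟩ := mem_flatten_ofFn.1 hA
        exact hMne f j A hA,
      hσM f, List.ofFn (M f), rfl, by
        rw [List.map_ofFn]
        exact congrArg List.ofFn (funext fun j => (hMP f j).symm)⟩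
  have hΨle : ∀ f f', OSPle (Ψ f).val (Ψ f').val ↔ ∀ j, refines (f j).val (f' j).val := by
    intro f f'
    constructor
    · intro h j
      rw [← refines_map_sup_iff (hgne j) (hgdisj j)]
      exact refines_of_refines_flatten_ofFn hPdisj (hMne f) (hMP f) (hMP f') h.refines j
    · intro h
      exact OSPle.flatten_ofFn fun j => ((f j).2.ospLE_of_refines (f' j).2 (h j)).map_sup (g j)
  have hrefl : ∀ {m : ℕ} (l : List (Block m)), refines l l := fun l A hA =>
    ⟨A, hA, Finset.Subset.refl A⟩
  have hΨ : Function.Bijective Ψ := by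
    constructor
    · intro f f' hff'
      have h₁ := (hΨle f f').1 (hff' ▸ (hΨle f f).2 fun j => hrefl _)
      have h₂ := (hΨle f' f).1 (hff' ▸ (hΨle f f).2 fun j => hrefl _)
      exact funext fun j => Subtype.ext ((f j).2.eq_of_refines (f' j).2 (h₁ j) (h₂ j))
    · rintro ⟨ρ, hρ, hσρ, hρπ⟩
      have hPg : P = fun j => unionList (List.ofFn (g j)) := funext fun j => (hgP j).symm
      obtain ⟨M', rfl, hM'⟩ := OSPle.exists_split hσ.1 hgσ (hPg ▸ hπ.2.1) hσρ (hPg ▸ hρπ)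
      choose f hf hfM' using fun j => (hM' j).exists_isIP fun A hA =>
        hρ.1 A (mem_flatten_ofFn.2 ⟨j, hA⟩)
      exact ⟨fun j => ⟨f j, hf j⟩, Subtype.ext
        (congrArg (fun M => (List.ofFn M).flatten) (funext fun j => (hfM' j).symm))⟩
  let e := Equiv.ofBijective Ψ hΨ
  refine ⟨e.symm, e.symm.bijective, fun ρ ρ' => ?_⟩
  have h := hΨle (e.symm ρ) (e.symm ρ')
  rwa [show Ψ (e.symm ρ) = ρ from e.apply_symm_apply ρ,
    show Ψ (e.symm ρ') = ρ' from e.apply_symm_apply ρ'] at h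

end Interval

/-- Let `σ = (S₁,…,S_s) ≤ π = (P₁,…,P_p)` in `OP_n`. Then there is a unique
interval partition `τ = (T₁,…,T_p)` of `[s]` (blocks in increasing order) such that
`π = (∪_{i∈T₁} S_i, …, ∪_{i∈T_p} S_i)`. Setting `k_j = |T_j|` (the number of blocks of `σ`
contained in `P_j`, with `k₁+⋯+k_p = s`), the interval `[σ,π] ⊆ OP_n` is order-isomorphic to
the product poset `IP_{k₁} × ⋯ × IP_{k_p}` with the componentwise (refinement) order. -/
theorem statement4 {n : ℕ} (σ π : List (Block n))
    (hσ : IsOSP Finset.univ σ) (hπ : IsOSP Finset.univ π) (h : OSPle σ π) :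
    ∃ τ : List (Finset (Fin σ.length)),
      (IsIP τ ∧ π = τ.map (fun T => T.sup (fun i => σ.get i))) ∧
      (∀ τ' : List (Finset (Fin σ.length)),
        IsIP τ' ∧ π = τ'.map (fun T => T.sup (fun i => σ.get i)) → τ' = τ) ∧
      (∀ j : Fin τ.length, (τ.get j).card = (restrict σ (π.getD j ∅)).length) ∧
      (τ.map Finset.card).sum = σ.length ∧
      ∃ Φ : {ρ : List (Block n) // IsOSP Finset.univ ρ ∧ OSPle σ ρ ∧ OSPle ρ π} →
          ((j : Fin τ.length) → {l : List (Finset (Fin (τ.get j).card)) // IsIP l}),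
        Function.Bijective Φ ∧
        ∀ ρ ρ', OSPle ρ.val ρ'.val ↔ ∀ j, refines ((Φ ρ) j).val ((Φ ρ') j).val := by
  have hne : ∀ i, (σ.get i).Nonempty := fun i => hσ.1 _ (List.get_mem σ i)
  obtain ⟨τ, hτ, rfl⟩ := OSPle.exists_isIP (g := fun i => σ.get i)
    (by rwa [show List.ofFn (fun i => σ.get i) = σ from List.ofFn_get σ]) hπ.1
  refine ⟨τ, ⟨hτ, rfl⟩, fun τ' hτ' => ?_, fun j => ?_, ?_, exists_interval_equiv hσ hτ hπ⟩
  · exact (List.map_injective_iff.2 (sup_injective hne hσ.disjoint_get) hτ'.2).symm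
  · have hj := length_restrict_ofFn hne hσ.disjoint_get (τ.get j)
    rw [show List.ofFn (fun i => σ.get i) = σ from List.ofFn_get σ] at hj
    rw [← hj, List.getD_eq_getElem _ _ (by simp), List.getElem_map]
    rfl
  · simpa [List.length_flatten, Function.comp_def] using congrArg List.length hτ.flatten_map_sort

end OSPpaper
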